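/- There is no divisible design Cayley graph with parameters (20, 9, 0, 4, 10, 2); that is, no simple graph on 20 vertices that is simultaneously a divisible design graph with parameters (20, 9, 0, 4, 10, 2) and a Cayley graph. -/

import Mathlib

/-- A divisible design graph (DDG) with parameters `(v, k, l1, l2, m, n)`:
a `k`-regular simple graph on `v = m * n` vertices whose vertex set can be partitioned
into `m` classes of size `n` such that two distinct vertices from the same class have
exactly `l1` common neighbours and two vertices from different classes have exactly `l2`
common neighbours. -/
def IsDDG {V : Type*} (Γ : SimpleGraph V) (v k l1 l2 m n : ℕ) : Prop :=
  Nat.card V = v ∧ v = m * n ∧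
  (∀ x : V, Nat.card {z : V // Γ.Adj x z} = k) ∧
  ∃ c : V → Fin m,
    (∀ i : Fin m, Nat.card {x : V // c x = i} = n) ∧
    (∀ x y : V, x ≠ y → c x = c y →
      Nat.card {z : V // Γ.Adj x z ∧ Γ.Adj y z} = l1) ∧
    (∀ x y : V, c x ≠ c y →
      Nat.card {z : V // Γ.Adj x z ∧ Γ.Adj y z} = l2)

/-- A simple graph is a Cayley graph if and only if its automorphism group contains a
subgroup acting regularly (sharply transitively) on the vertices. -/
def IsCayleyGraph {V : Type*} (Γ : SimpleGraph V) : Prop :=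
  ∃ H : Subgroup (Equiv.Perm V),
    (∀ g ∈ H, ∀ x y : V, Γ.Adj (g x) (g y) ↔ Γ.Adj x y) ∧
    ∀ x y : V, ∃! g : Equiv.Perm V, g ∈ H ∧ g x = y

section CayleyConnectionSet

open Finset

universe u

variable {G : Type u} [Group G]

/-- In a group of order 20 the Sylow 5-subgroup is normal. -/
theorem exists_normal_card_five [Finite G] (hG : Nat.card G = 20) :
    ∃ P : Subgroup G, P.Normal ∧ Nat.card P = 5 := by
  have : Fact (Nat.Prime 5) := ⟨by norm_num⟩
  obtain ⟨P⟩ : Nonempty (Sylow 5 G) := inferInstance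
  have hP : Nat.card P = 5 := by
    rw [P.card_eq_multiplicity, hG]
    have : Nat.factorization 20 5 = 1 := by
      rw [Nat.factorization_def _ (by norm_num)]
      have := padicValNat.mul (p := 5) (a := 5) (b := 4) (by norm_num) (by norm_num)
      rw [show 20 = 5 * 4 from rfl, this, padicValNat_self,
        padicValNat.eq_zero_of_not_dvd (by norm_num)]
    rw [this, pow_one]
  have hidx : (P : Subgroup G).index = 4 := by
    have := (P : Subgroup G).card_mul_index
    rw [hG] at this
    have h' : Nat.card (P : Subgroup G) = 5 := hP
    rw [h'] at this
    omega
  have hdvd : Nat.card (Sylow 5 G) ∣ 4 := hidx ▸ P.card_dvd_index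
  have hmod := card_sylow_modEq_one 5 G
  have hle := Nat.le_of_dvd (by norm_num) hdvd
  have hone : Nat.card (Sylow 5 G) = 1 := by
    unfold Nat.ModEq at hmod
    omega
  have : Subsingleton (Sylow 5 G) := (Nat.card_eq_one_iff_unique.mp hone).1
  exact ⟨P, P.normal_of_subsingleton, hP⟩

/-- A group of order 20 maps onto an abelian group of order 4. -/
theorem exists_hom_card_four (hG : Nat.card G = 20) :
    ∃ (P : Subgroup G) (_ : P.Normal) (Q : Type u) (_ : CommGroup Q) (π : G →* Q),
      Nat.card P = 5 ∧ Nat.card Q = 4 ∧ Function.Surjective π ∧ ∀ g, π g = 1 ↔ g ∈ P := by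
  have : Finite G := Nat.finite_of_card_ne_zero (by omega)
  obtain ⟨P, hN, hP⟩ := exists_normal_card_five hG
  have hQ : Nat.card (G ⧸ P) = 4 := by
    have := P.card_eq_card_quotient_mul_card_subgroup
    rw [hG, hP] at this
    omega
  have : Fact (Nat.Prime 2) := ⟨Nat.prime_two⟩
  refine ⟨P, hN, G ⧸ P, IsPGroup.commGroupOfCardEqPrimeSq (p := 2) (by rw [hQ]; norm_num),
    QuotientGroup.mk' P, hP, hQ, QuotientGroup.mk'_surjective P, fun g => ?_⟩
  exact QuotientGroup.eq_one_iff g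

/-- Counting the pairs of elements of `S` whose quotient lies over `c`, in two ways. -/
theorem sum_card_fiber_mul_card_fiber [Fintype G] [DecidableEq G] {Q : Type*} [Group Q]
    [Fintype Q] [DecidableEq Q] (π : G →* Q) (S : Finset G) (c : Q) :
    ∑ q : Q, #{x ∈ S | π x = c * q} * #{x ∈ S | π x = q} =
      ∑ g : G with π g = c, #{y ∈ S | g * y ∈ S} := by
  have h1 : #{p ∈ S ×ˢ S | π p.1 = c * π p.2} =
      ∑ q : Q, #{x ∈ S | π x = c * q} * #{x ∈ S | π x = q} := by
    rw [card_eq_sum_card_fiberwise (f := fun p : G × G => π p.2) (t := univ) (by simp)]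
    refine sum_congr rfl fun q _ => ?_
    rw [← card_product]
    congr 1
    ext ⟨x, y⟩
    simp only [mem_filter, mem_product]
    constructor
    · rintro ⟨⟨⟨hx, hy⟩, h⟩, rfl⟩
      exact ⟨⟨hx, h⟩, hy, rfl⟩
    · rintro ⟨⟨hx, h⟩, hy, rfl⟩
      exact ⟨⟨⟨hx, hy⟩, h⟩, rfl⟩
  rw [← h1, card_eq_sum_card_fiberwise (f := fun p : G × G => p.1 * p.2⁻¹)
    (t := univ.filter fun g => π g = c)]
  · refine sum_congr rfl fun g hg => ?_
    refine card_bij' (fun p _ => p.2) (fun y _ => (g * y, y)) ?_ ?_ ?_ ?_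
    · rintro ⟨x, y⟩ h
      simp only [mem_filter, mem_product] at h ⊢
      obtain ⟨⟨⟨hx, hy⟩, -⟩, rfl⟩ := h
      simpa using ⟨hy, hx⟩
    · intro y h
      simp only [mem_filter, mem_univ, true_and, mem_product] at h hg ⊢
      simp [h, hg]
    · rintro ⟨x, y⟩ h
      simp only [mem_filter, mem_product] at h
      obtain ⟨-, rfl⟩ := h
      simp
    · simp
  · rintro ⟨x, y⟩ h
    simp only [coe_filter, Set.mem_ofPred_eq, mem_product, mem_univ, true_and] at h ⊢
    simp [h.2]

/-- An automorphism of order at most two of a group of order five, given by conjugation with an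
involution, fixes or inverts each element. -/
theorem conj_eq_or_eq_inv {P : Subgroup G} [P.Normal] (hP : Nat.card P = 5) {u d : G}
    (hu : u ∈ P) (hu1 : u ≠ 1) (hd : d⁻¹ = d) :
    d * u * d = u ∨ d * u * d = u⁻¹ := by
  have : Fact (Nat.Prime 5) := ⟨by norm_num⟩
  have hdd : d * d = 1 := by nth_rw 1 [← hd]; simp
  have hmem : d * u * d ∈ P := by
    simpa [hd] using Subgroup.Normal.conj_mem ‹P.Normal› u hu d
  have hord : orderOf u = 5 := by
    refine orderOf_eq_prime ?_ hu1
    have := pow_card_eq_one' (x := (⟨u, hu⟩ : P))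
    rw [hP] at this
    simpa using congrArg Subtype.val this
  obtain ⟨k, hk⟩ : ∃ k : ℤ, u ^ k = d * u * d := by
    have := mem_zpowers_of_prime_card hP (g := (⟨u, hu⟩ : P)) (g' := ⟨_, hmem⟩)
      (by simpa [Subtype.ext_iff] using hu1)
    obtain ⟨k, hk⟩ := this
    exact ⟨k, by simpa using congrArg Subtype.val hk⟩
  have hkk : u ^ (k * k) = u := by
    have h := conj_zpow (a := d) (b := u) (i := k)
    rw [hd, ← hk, ← zpow_mul] at h
    rw [h, hk]
    simp only [← mul_assoc, hdd, one_mul]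
    rw [mul_assoc, hdd, mul_one]
  have hdvd : (5 : ℤ) ∣ (k - 1) * (k + 1) := by
    have : u ^ (k * k - 1) = 1 := by rw [zpow_sub, hkk]; simp
    have := orderOf_dvd_iff_zpow_eq_one.mpr this
    rw [hord] at this
    have hfactor : (k - 1) * (k + 1) = k * k - 1 := by ring
    rw [hfactor]
    exact_mod_cast this
  rcases Int.Prime.dvd_mul' (by norm_num : Nat.Prime 5) hdvd with h | h
  · left
    have : u ^ (k - 1) = 1 := orderOf_dvd_iff_zpow_eq_one.mp (by rw [hord]; exact h)
    rw [← hk, ← mul_inv_eq_one, ← zpow_sub_one, this]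
  · right
    have : u ^ (k + 1) = 1 := orderOf_dvd_iff_zpow_eq_one.mp (by rw [hord]; exact h)
    rw [← hk, eq_inv_iff_mul_eq_one, ← zpow_add_one, this]

/-- The intersection sizes of the connection set with the four cosets of the Sylow 5-subgroup. -/
theorem fiber_sizes {a b c d : ℕ} (ha : a % 2 = 0) (hle : a ≤ 4)
    (hsum : a + b + c + d = 9) (hsq : a * a + b * b + c * c + d * d = 25)
    (hmul : b * a + a * b + d * c + c * d = 16) :
    (a = 4 ∧ b = 1 ∧ c = 2) ∨ (a = 2 ∧ c = 4 ∧ d = 1) ∨ (a = 2 ∧ d = 4 ∧ c = 1) := by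
  have hb : b ≤ 5 := by nlinarith
  have hc : c ≤ 5 := by nlinarith
  obtain rfl : d = 9 - a - b - c := by omega
  interval_cases a <;> interval_cases b <;> interval_cases c <;> simp_all

variable [Fintype G] [DecidableEq G] {S : Finset G} {t : G}
  {Q : Type*} [CommGroup Q] [DecidableEq Q] {π : G →* Q} {α : Q}

theorem false_of_fiber_sizes_four_one_two
    (hQ : ∀ q : Q, q = 1 ∨ q = π t ∨ q = α ∨ q = π t * α)
    (hα1 : α ≠ 1) (hαt : α ≠ π t)
    (hker : #{g : G | π g = 1} = 5) (h1 : 1 ∉ S) (hinv : ∀ s ∈ S, s⁻¹ ∈ S) (htt : t * t = 1)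
    (hdisj : ∀ s ∈ S, t * s ∉ S) (hdisj' : ∀ s ∈ S, s * t ∉ S)
    (hN : ∀ g, g ≠ 1 → g ≠ t → #{y ∈ S | g * y ∈ S} = 4)
    (hs1 : #{x ∈ S | π x = 1} = 4) (hsα : #{x ∈ S | π x = α} = 2) : False := by
  have hττ : π t * π t = 1 := by rw [← map_mul, htt, map_one]
  have hPS : ∀ p, π p = 1 → p ≠ 1 → p ∈ S := by
    have hsub : ({x ∈ S | π x = 1} : Finset G) ⊆ ({g : G | π g = 1} : Finset G).erase 1 := by
      intro x hx
      simp only [mem_filter, mem_erase, mem_univ, true_and] at hx ⊢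
      exact ⟨fun h => h1 (h ▸ hx.1), hx.2⟩
    have heq := eq_of_subset_of_card_le hsub (by
      rw [card_erase_of_mem (by simp), hker, hs1])
    intro p hp hp1
    have : p ∈ ({x ∈ S | π x = 1} : Finset G) := by rw [heq]; simp [hp, hp1]
    exact (mem_filter.mp this).1
  have htS : ∀ y ∈ S, π y = π t → y = t := by
    intro y hy hyt
    by_contra hne
    refine hdisj y hy (hPS _ (by rw [map_mul, hyt, hττ]) fun h => hne ?_)
    rw [← mul_left_cancel (h.trans htt.symm)]
  obtain ⟨x, x', -, hfib⟩ := card_eq_two.mp hsα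
  have hmem : ∀ y ∈ S, π y = α → y = x ∨ y = x' := by
    intro y hy hyα
    have : y ∈ ({x ∈ S | π x = α} : Finset G) := by simp [hy, hyα]
    rw [hfib] at this
    simpa using this
  obtain ⟨hxS, hxα⟩ : x ∈ S ∧ π x = α := by
    have : x ∈ ({x ∈ S | π x = α} : Finset G) := by rw [hfib]; simp
    simpa using this
  have hle : #{y ∈ S | x * y ∈ S} ≤ 2 := by
    refine le_trans (card_le_card (t := {x⁻¹ * x', x'⁻¹}) ?_) card_le_two
    intro y hy
    obtain ⟨hy, hxy⟩ := mem_filter.mp hy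
    simp only [mem_insert, mem_singleton]
    rcases hQ (π (x * y)) with h | h | h | h
    · right
      rw [map_mul, hxα] at h
      rcases hmem y⁻¹ (hinv y hy) (by rw [map_inv, eq_comm, eq_inv_iff_mul_eq_one, h])
        with h' | h'
      · rw [← h', inv_mul_cancel] at hxy
        exact absurd hxy h1
      · rw [← h', inv_inv]
    · have h' := htS _ hxy h
      have : y⁻¹ = t * x := by
        rw [eq_inv_mul_of_mul_eq h', mul_inv_rev, inv_inv, inv_eq_of_mul_eq_one_left htt]
      exact absurd (this ▸ hinv y hy) (hdisj x hxS)
    · left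
      rcases hmem _ hxy h with h' | h'
      · rw [mul_eq_left] at h'
        exact absurd (h' ▸ hy) h1
      · rw [← h', inv_mul_cancel_left]
    · rw [map_mul, hxα, mul_comm, mul_left_inj] at h
      rw [htS y hy h] at hxy
      exact absurd hxy (hdisj' x hxS)
  rw [hN x (by rintro rfl; exact hα1 (by simpa using hxα.symm))
    (by rintro rfl; exact hαt hxα.symm)] at hle
  omega

theorem false_of_fiber_sizes_two_four_one
    (hQ : ∀ q : Q, q = 1 ∨ q = π t ∨ q = α ∨ q = π t * α)
    (hα1 : α ≠ 1) (hαt : α ≠ π t) (hpow : ∀ g, π g = 1 → g ^ 5 = 1)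
    (hconj : ∀ u d, π u = 1 → u ≠ 1 → d⁻¹ = d → d * u * d = u ∨ d * u * d = u⁻¹)
    (hfiber : #{g : G | π g = α} = 5) (h1 : 1 ∉ S) (hinv : ∀ s ∈ S, s⁻¹ ∈ S) (htt : t * t = 1)
    (hdisj : ∀ s ∈ S, t * s ∉ S) (hdisj' : ∀ s ∈ S, s * t ∉ S)
    (hN : ∀ g, g ≠ 1 → g ≠ t → #{y ∈ S | g * y ∈ S} = 4)
    (hs1 : #{x ∈ S | π x = 1} = 2) (hst : #{x ∈ S | π x = π t} ≠ 1)
    (hsα : #{x ∈ S | π x = α} = 4) (hsτα : #{x ∈ S | π x = π t * α} = 1) : False := by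
  have hττ : π t * π t = 1 := by rw [← map_mul, htt, map_one]
  have htinv : t⁻¹ = t := inv_eq_of_mul_eq_one_left htt
  obtain ⟨d, hfibd⟩ := card_eq_one.mp hsτα
  have hmemd : ∀ y ∈ S, π y = π t * α → y = d := by
    intro y hy hyα
    have : y ∈ ({x ∈ S | π x = π t * α} : Finset G) := by simp [hy, hyα]
    rw [hfibd] at this
    simpa using this
  obtain ⟨hdS, hdπ⟩ : d ∈ S ∧ π d = π t * α := by
    have : d ∈ ({x ∈ S | π x = π t * α} : Finset G) := by rw [hfibd]; simp
    simpa using this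
  have hmiss : ∀ y z, y ∉ S → z ∉ S → π y = α → π z = α → y = z := by
    have hsdiff : #(({g : G | π g = α} : Finset G) \ {x ∈ S | π x = α}) = 1 := by
      rw [card_sdiff_of_subset (filter_subset_filter _ (subset_univ S)), hfiber, hsα]
    intro y z hy hz hyα hzα
    exact card_le_one.mp hsdiff.le y (by simp [hy, hyα]) z (by simp [hz, hzα])
  have htdα : π (t * d) = α := by rw [map_mul, hdπ, ← mul_assoc, hττ, one_mul]
  have htd : t * d = d * t := hmiss _ _ (hdisj d hdS) (hdisj' d hdS) htdα
    (by rw [map_mul, hdπ, mul_right_comm, hττ, one_mul])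
  have hsymm : ∀ q, #{x ∈ S | π x = q⁻¹} = #{x ∈ S | π x = q} := by
    intro q
    refine card_bij' (fun x _ => x⁻¹) (fun x _ => x⁻¹) ?_ ?_ (by simp) (by simp)
    · intro x hx
      simp only [mem_filter] at hx ⊢
      exact ⟨hinv x hx.1, by rw [map_inv, hx.2, inv_inv]⟩
    · intro x hx
      simp only [mem_filter] at hx ⊢
      exact ⟨hinv x hx.1, by rw [map_inv, hx.2]⟩
  have hd : d⁻¹ = d := by
    refine hmemd _ (hinv d hdS) ?_
    have h := hsymm (π d)
    rw [← map_inv, hdπ, hsτα] at h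
    rcases hQ (π d⁻¹) with h' | h' | h' | h'
    · rw [h', hs1] at h
      omega
    · rw [h'] at h
      exact absurd h hst
    · rw [h', hsα] at h
      omega
    · exact h'
  have hdd : d * d = 1 := by nth_rw 1 [← hd]; simp
  obtain ⟨u, u', -, hfib⟩ := card_eq_two.mp hs1
  have hmem : ∀ y ∈ S, π y = 1 → y = u ∨ y = u' := by
    intro y hy hyα
    have : y ∈ ({x ∈ S | π x = 1} : Finset G) := by simp [hy, hyα]
    rw [hfib] at this
    simpa using this
  obtain ⟨huS, huπ⟩ : u ∈ S ∧ π u = 1 := by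
    have : u ∈ ({x ∈ S | π x = 1} : Finset G) := by rw [hfib]; simp
    simpa using this
  have hu1 : u ≠ 1 := fun h => h1 (h ▸ huS)
  obtain rfl : u⁻¹ = u' := by
    refine (hmem _ (hinv u huS) (by rw [map_inv, huπ, inv_one])).resolve_left fun h => hu1 ?_
    have huu : u * u = 1 := by nth_rw 1 [← h]; simp
    have := hpow u huπ
    rwa [show u ^ 5 = u * u * (u * u) * u by
      simp only [pow_succ, pow_zero, one_mul, mul_assoc], huu, one_mul, one_mul] at this
  have hle : #{y ∈ S | u * t * d * y ∈ S} ≤ 3 := by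
    refine le_trans (card_le_card (t := {(u * t * d)⁻¹ * u⁻¹, u, u⁻¹}) ?_) card_le_three
    intro y hy
    obtain ⟨hy, hgy⟩ := mem_filter.mp hy
    have hgα : π (u * t * d) = α := by rw [mul_assoc, map_mul, huπ, one_mul, htdα]
    simp only [mem_insert, mem_singleton]
    rcases hQ (π (u * t * d * y)) with h | h | h | h
    · left
      rcases hmem _ hgy h with h' | h'
      · have : y⁻¹ = t * d :=
          inv_eq_of_mul_eq_one_left (by simpa [mul_assoc] using h')
        exact absurd (this ▸ hinv y hy) (hdisj d hdS)
      · rw [← h', inv_mul_cancel_left]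
    · have : y⁻¹ = d := by
        refine hmemd _ (hinv y hy) ?_
        rw [map_mul, hgα] at h
        rw [map_inv]
        exact inv_eq_of_mul_eq_one_left (by rw [mul_assoc, h, hττ])
      rw [← this, inv_mul_cancel_right] at hgy
      exact absurd hgy (hdisj' u huS)
    · right
      rw [map_mul, hgα, mul_eq_left] at h
      exact hmem y hy h
    · exfalso
      have h' := hmemd _ hgy h
      have hy' : y = t * (d * u⁻¹ * d) := by
        rw [eq_inv_mul_of_mul_eq h', mul_inv_rev, mul_inv_rev, hd, htinv, ← mul_assoc d, ← htd]
        simp only [mul_assoc]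
      rcases hconj u⁻¹ d (by rw [map_inv, huπ, inv_one]) (inv_ne_one.mpr hu1) hd with hc | hc
      · rw [hy', hc] at hy
        exact hdisj _ (hinv u huS) hy
      · rw [hy', hc, inv_inv] at hy
        exact hdisj _ huS hy
  have hg : π (u * t * d) = α := by rw [mul_assoc, map_mul, huπ, one_mul, htdα]
  rw [hN (u * t * d) (by intro h; rw [h, map_one] at hg; exact hα1 hg.symm)
    (by intro h; rw [h] at hg; exact hαt hg.symm)] at hle
  omega

/-- No group of order 20 has a connection set of a divisible design graph with parameters
`(20, 9, 0, 4, 10, 2)`; here `t` is the other element of the class of the identity. -/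
theorem false_of_connection_set (hG : Nat.card G = 20) (S : Finset G)
    (hS : #S = 9) (h1 : 1 ∉ S) (hinv : ∀ s ∈ S, s⁻¹ ∈ S) {t : G} (ht1 : t ≠ 1)
    (hdisj : ∀ s ∈ S, t * s ∉ S)
    (hN : ∀ g, g ≠ 1 → g ≠ t → #{y ∈ S | g * y ∈ S} = 4) : False := by
  classical
  obtain ⟨P, hPn, Q, _, π, hP, hQc, hsurj, hπ⟩ := exists_hom_card_four hG
  have : Finite Q := Nat.finite_of_card_ne_zero (by omega)
  have : Fintype Q := Fintype.ofFinite Q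
  have hdisjinv : ∀ s ∈ S, t⁻¹ * s ∉ S := fun s hs h =>
    hdisj _ h (by rwa [mul_inv_cancel_left])
  have htt : t * t = 1 := by
    by_contra hne
    have h := hN t⁻¹ (inv_ne_one.mpr ht1) fun h => hne (by nth_rw 1 [← h]; simp)
    rw [filter_false_of_mem hdisjinv] at h
    simp at h
  have htinv : t⁻¹ = t := inv_eq_of_mul_eq_one_left htt
  have hdisj' : ∀ s ∈ S, s * t ∉ S := fun s hs h =>
    hdisj _ (hinv s hs) (by simpa [htinv] using hinv _ h)
  have hpow : ∀ g, π g = 1 → g ^ 5 = 1 := by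
    intro g hg
    have := pow_card_eq_one' (x := (⟨g, (hπ g).mp hg⟩ : P))
    rw [hP] at this
    simpa using congrArg Subtype.val this
  have hτ1 : π t ≠ 1 := by
    intro h
    have := hpow t h
    rw [show t ^ 5 = t * t * (t * t) * t by
      simp only [pow_succ, pow_zero, one_mul, mul_assoc], htt, one_mul, one_mul] at this
    exact ht1 this
  have hττ : π t * π t = 1 := by rw [← map_mul, htt, map_one]
  have hker : #{g : G | π g = 1} = 5 := by
    rw [← hP, Nat.card_eq_fintype_card, Fintype.card_subtype]
    simp only [hπ]
  have hfiber : ∀ q, #{g : G | π g = q} = 5 := by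
    intro q
    obtain ⟨x, rfl⟩ := hsurj q
    rw [← hker]
    refine card_bij' (fun g _ => x⁻¹ * g) (fun g _ => x * g) ?_ ?_ (by simp) (by simp)
    · intro g hg
      simp only [mem_filter, mem_univ, true_and] at hg ⊢
      rw [map_mul, hg, map_inv, inv_mul_cancel]
    · intro g hg
      simp only [mem_filter, mem_univ, true_and] at hg ⊢
      rw [map_mul, hg, mul_one]
  have hcardQ : Fintype.card Q = 4 := by rw [← Nat.card_eq_fintype_card, hQc]
  obtain ⟨α, hα⟩ : ∃ α, α ∉ ({1, π t} : Finset Q) := by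
    by_contra! h
    have h4 := card_le_card (fun x _ => h x : (univ : Finset Q) ⊆ {1, π t})
    rw [card_univ, hcardQ] at h4
    have := card_le_two (a := (1 : Q)) (b := π t)
    omega
  simp only [mem_insert, mem_singleton, not_or] at hα
  obtain ⟨hα1, hατ⟩ := hα
  have hτα1 : π t * α ≠ 1 := fun h => hατ (mul_left_cancel (h.trans hττ.symm))
  have hτατ : π t * α ≠ π t := fun h => hα1 (mul_eq_left.mp h)
  have hnotMem1 : (1 : Q) ∉ ({π t, α, π t * α} : Finset Q) := by
    simp [hτ1.symm, Ne.symm hα1, hτα1.symm]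
  have hnotMemτ : π t ∉ ({α, π t * α} : Finset Q) := by
    simp [Ne.symm hατ, hα1]
  have hnotMemα : α ∉ ({π t * α} : Finset Q) := by simp [hτ1]
  have huniv : (univ : Finset Q) = {1, π t, α, π t * α} := by
    symm
    rw [← card_eq_iff_eq_univ, card_insert_of_notMem hnotMem1, card_insert_of_notMem hnotMemτ,
      card_insert_of_notMem hnotMemα, card_singleton, hcardQ]
  have hsum : ∀ f : Q → ℕ, ∑ q, f q = f 1 + f (π t) + f α + f (π t * α) := by
    intro f
    rw [huniv, sum_insert hnotMem1, sum_insert hnotMemτ, sum_insert hnotMemα, sum_singleton]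
    ring
  have hQ : ∀ q : Q, q = 1 ∨ q = π t ∨ q = α ∨ q = π t * α := by
    intro q
    have := mem_univ q
    rw [huniv] at this
    simpa using this
  have hS9 := card_eq_sum_card_fiberwise (f := π) (s := S) (t := univ) (by simp)
  rw [hS, hsum] at hS9
  have hsq := sum_card_fiber_mul_card_fiber π S 1
  have hmul := sum_card_fiber_mul_card_fiber π S (π t)
  rw [hsum, ← add_sum_erase _ _ (a := 1) (by simp), sum_congr rfl (g := fun _ => 4),
    sum_const, card_erase_of_mem (by simp), hker] at hsq
  swap
  · intro g hg
    simp only [mem_erase, mem_filter] at hg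
    exact hN g hg.1 fun h => hτ1 (h ▸ hg.2.2)
  rw [hsum, ← add_sum_erase _ _ (a := t) (by simp), sum_congr rfl (g := fun _ => 4),
    sum_const, card_erase_of_mem (by simp), hfiber] at hmul
  swap
  · intro g hg
    simp only [mem_erase, mem_filter] at hg
    exact hN g (fun h => hτ1 (by rw [← hg.2.2, h, map_one])) hg.1
  simp only [one_mul, mul_one, ← mul_assoc, hττ, filter_false_of_mem hdisj, card_empty, zero_add,
    filter_mem_eq_inter, inter_self, hS, smul_eq_mul] at hsq hmul
  have hle : #{x ∈ S | π x = 1} ≤ 4 := by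
    have hsub : ({x ∈ S | π x = 1} : Finset G) ⊆ ({g : G | π g = 1} : Finset G).erase 1 := by
      intro x hx
      simp only [mem_filter, mem_erase, mem_univ, true_and] at hx ⊢
      exact ⟨fun h => h1 (h ▸ hx.1), hx.2⟩
    have := card_le_card hsub
    rwa [card_erase_of_mem (by simp), hker] at this
  have heven : #{x ∈ S | π x = 1} % 2 = 0 := by
    rw [← Nat.even_iff, ← ZMod.natCast_eq_zero_iff_even, ← nsmul_one, ← sum_const]
    refine sum_involution (fun x _ => x⁻¹) (fun _ _ => by decide) ?_ ?_ (by simp)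
    · intro x hx _ h
      simp only [mem_filter] at hx
      have hxx : x * x = 1 := by nth_rw 1 [← h]; simp
      have h5 := hpow x hx.2
      rw [show x ^ 5 = x * x * (x * x) * x by
        simp only [pow_succ, pow_zero, one_mul, mul_assoc], hxx, one_mul, one_mul] at h5
      exact h1 (h5 ▸ hx.1)
    · intro x hx
      simp only [mem_filter] at hx ⊢
      exact ⟨hinv x hx.1, by rw [map_inv, hx.2, inv_one]⟩
  have hconj : ∀ u d, π u = 1 → u ≠ 1 → d⁻¹ = d → d * u * d = u ∨ d * u * d = u⁻¹ :=
    fun u d hu hu1 hd => conj_eq_or_eq_inv hP ((hπ u).mp hu) hu1 hd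
  rcases fiber_sizes heven hle hS9.symm hsq hmul with ⟨ha, -, hc⟩ | ⟨ha, hc, hd⟩ | ⟨ha, hd, hc⟩
  · exact false_of_fiber_sizes_four_one_two hQ hα1 hατ hker h1 hinv htt hdisj hdisj' hN ha hc
  · refine false_of_fiber_sizes_two_four_one hQ hα1 hατ hpow hconj (hfiber α) h1 hinv htt hdisj
      hdisj' hN ha ?_ hc hd
    intro h
    omega
  · have hα' : π t * (π t * α) = α := by rw [← mul_assoc, hττ, one_mul]
    refine false_of_fiber_sizes_two_four_one (α := π t * α) ?_ hτα1 hτατ hpow hconj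
      (hfiber _) h1 hinv htt hdisj hdisj' hN ha ?_ hd (by rw [hα']; exact hc)
    · intro q
      rw [hα']
      have := hQ q
      tauto
    · intro h
      omega

end CayleyConnectionSet

/-- There is no divisible design Cayley graph with parameters
`(20, 9, 0, 4, 10, 2)`. -/
theorem no_ddcg_20_9_0_4_10_2 :
    ¬ ∃ (V : Type) (Γ : SimpleGraph V),
        IsDDG Γ 20 9 0 4 10 2 ∧ IsCayleyGraph Γ := by
  classical
  rintro ⟨V, Γ, ⟨hV, -, hreg, c, hc, hsame, hdiff⟩, H, haut, htrans⟩
  have : Finite V := Nat.finite_of_card_ne_zero (by omega)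
  obtain ⟨v⟩ : Nonempty V := (Nat.card_pos_iff.mp (by omega)).1
  let e : H ≃ V := Equiv.ofBijective (fun g => g.1 v) (by
    constructor
    · intro g h hgh
      exact Subtype.ext ((htrans v (h.1 v)).unique ⟨g.2, hgh⟩ ⟨h.2, rfl⟩)
    · intro x
      obtain ⟨g, ⟨hg, hx⟩, -⟩ := htrans v x
      exact ⟨⟨g, hg⟩, hx⟩)
  have he : ∀ g : H, e g = g.1 v := fun _ => rfl
  have : Fintype H := Fintype.ofFinite H
  let S : Finset H := Finset.univ.filter fun g => Γ.Adj v (e g)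
  have hmem : ∀ g, g ∈ S ↔ Γ.Adj v (e g) := fun g => by simp [S]
  have hadj : ∀ g h : H, Γ.Adj (e g⁻¹) (e h) ↔ g * h ∈ S := by
    intro g h
    rw [hmem, ← haut g.1 g.2]
    simp [he]
  have hone : e 1 = v := by simp [he]
  have hcard : ∀ g : H, (S.filter fun y => g * y ∈ S).card =
      Nat.card {z : V // Γ.Adj v z ∧ Γ.Adj (e g⁻¹) z} := by
    intro g
    rw [← Fintype.card_coe, ← Nat.card_eq_fintype_card]
    exact Nat.card_congr (e.subtypeEquiv fun y => by
      rw [Finset.mem_filter, hmem, hadj])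
  have hinv : ∀ s ∈ S, s⁻¹ ∈ S := by
    intro s hs
    rw [← mul_one s⁻¹, ← hadj, inv_inv, hone, Γ.adj_comm, ← hmem]
    exact hs
  obtain ⟨w, hwv, hw⟩ : ∃ w, w ≠ v ∧ ∀ x, c v = c x ↔ x = v ∨ x = w := by
    have h2 := hc (c v)
    have : Fintype V := Fintype.ofFinite V
    rw [Nat.card_eq_fintype_card, Fintype.card_subtype] at h2
    obtain ⟨a, b, hab, hfib⟩ := Finset.card_eq_two.mp h2
    have hmem' : ∀ x, c v = c x ↔ x = a ∨ x = b := by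
      intro x
      have hx : x ∈ ({x | c x = c v} : Finset V) ↔ x ∈ ({a, b} : Finset V) := by rw [hfib]
      simpa [eq_comm] using hx
    rcases (hmem' v).mp rfl with rfl | rfl
    · exact ⟨b, hab.symm, hmem'⟩
    · exact ⟨a, hab, fun x => (hmem' x).trans or_comm⟩
  obtain ⟨t, rfl⟩ : ∃ t : H, e t⁻¹ = w := ⟨(e.symm w)⁻¹, by simp⟩
  refine false_of_connection_set (t := t) (by rw [Nat.card_congr e, hV]) S ?_ ?_ hinv ?_ ?_ ?_
  · rw [← hreg v, ← Fintype.card_coe, ← Nat.card_eq_fintype_card]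
    exact Nat.card_congr (e.subtypeEquiv hmem)
  · rw [hmem, hone]
    exact Γ.loopless.irrefl v
  · rintro rfl
    exact hwv (by rw [inv_one, hone])
  · rw [← Finset.filter_eq_empty_iff, ← Finset.card_eq_zero, hcard]
    exact hsame _ _ hwv.symm ((hw _).mpr (Or.inr rfl))
  · intro g hg1 hgt
    rw [hcard]
    refine hdiff _ _ fun h => ?_
    rcases (hw _).mp h with h | h
    · rw [← hone, e.injective.eq_iff, inv_eq_one] at h
      exact hg1 h
    · rw [e.injective.eq_iff, inv_inj] at h
      exact hgt h
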